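/- Let d ≥ 1 and k ∈ {0, …, d}. Let H ∈ M_d(ℝ) be symmetric and invertible with exactly k negative eigenvalues counted with multiplicity (so d − k positive eigenvalues), let A ∈ M_d(ℝ) be symmetric positive semidefinite, and let J ∈ M_d(ℝ) be antisymmetric. Assume that for every z ∈ ℂ, the only vector v ∈ ℂ^d with A v = 0 and (HJ) v = z v is v = 0. Then the characteristic polynomial of Λ := H(2A + J) = 2HA + HJ has, counted with multiplicity, exactly k roots with negative real part, exactly d − k roots with positive real part, and no root with real part zero. Moreover, if k = 1, then the unique root with negative real part is a (negative) real number. -/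

import Mathlib

open Matrix Polynomial

open Filter Topology in
/-- The initial values of the solutions of `u' = M u` that tend to zero at `+∞`. -/
def decayingSubmodule {n : Type*} [Fintype n] (M : Matrix n n ℂ) : Submodule ℂ (n → ℂ) where
  carrier := {x | ∃ u : ℝ → n → ℂ, u 0 = x ∧ (∀ t, HasDerivAt u (M *ᵥ u t) t) ∧
    Tendsto u atTop (𝓝 0)}
  add_mem' := by
    rintro _ _ ⟨u, rfl, hu, hu'⟩ ⟨v, rfl, hv, hv'⟩
    refine ⟨u + v, rfl, fun t => ?_, by
      rw [← add_zero (0 : n → ℂ)]; exact hu'.add hv'⟩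
    simpa [mulVec_add] using (hu t).add (hv t)
  zero_mem' := ⟨0, rfl, fun t => by simp,
    tendsto_const_nhds⟩
  smul_mem' := by
    rintro c _ ⟨u, rfl, hu, hu'⟩
    refine ⟨c • u, rfl, fun t => ?_, by
      rw [← smul_zero c]; exact hu'.const_smul c⟩
    simpa [mulVec_smul] using (hu t).const_smul c

section

variable {n : Type*} [Fintype n]

lemma HasDerivAt.matrix_mulVec {u : ℝ → n → ℂ} {u' : n → ℂ} {t : ℝ} (M : Matrix n n ℂ)
    (hu : HasDerivAt u u' t) : HasDerivAt (fun s => M *ᵥ u s) (M *ᵥ u') t := by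
  rw [hasDerivAt_pi] at hu ⊢
  intro i
  simp only [mulVec, dotProduct]
  exact HasDerivAt.fun_sum fun j _ => (hu j).const_mul (M i j)

lemma HasDerivAt.matrix_dotProduct {u v : ℝ → n → ℂ} {u' v' : n → ℂ} {t : ℝ}
    (hu : HasDerivAt u u' t) (hv : HasDerivAt v v' t) :
    HasDerivAt (fun s => u s ⬝ᵥ v s) (u' ⬝ᵥ v t + u t ⬝ᵥ v') t := by
  rw [hasDerivAt_pi] at hu hv
  simp only [dotProduct, ← Finset.sum_add_distrib]
  exact HasDerivAt.fun_sum fun j _ => (hu j).mul (hv j)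

lemma mulVec_mem_decayingSubmodule {M : Matrix n n ℂ} {x : n → ℂ}
    (hx : x ∈ decayingSubmodule M) : M *ᵥ x ∈ decayingSubmodule M := by
  obtain ⟨u, rfl, hu, hu'⟩ := hx
  refine ⟨fun t => M *ᵥ u t, rfl, fun t => (hu t).matrix_mulVec M, ?_⟩
  have hM : Continuous fun y : n → ℂ => M *ᵥ y := by fun_prop
  rw [← mulVec_zero M]
  exact (hM.tendsto 0).comp hu'

open Filter Topology in
lemma tendsto_cexp_mul_pow_div_factorial {μ : ℂ} (hμ : μ.re < 0) (j : ℕ) :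
    Tendsto (fun t : ℝ => Complex.exp (μ * t) * ((t : ℂ) ^ j / (j.factorial : ℂ))) atTop (𝓝 0) := by
  rw [tendsto_zero_iff_norm_tendsto_zero]
  have h := (tendsto_rpow_mul_exp_neg_mul_atTop_nhds_zero j (-μ.re) (by linarith)).mul_const
    ((j.factorial : ℝ)⁻¹)
  rw [zero_mul] at h
  refine h.congr' ?_
  filter_upwards [eventually_ge_atTop 0] with t ht
  simp only [Complex.norm_mul, Complex.norm_exp, norm_div, norm_pow, Complex.norm_real,
    Real.norm_of_nonneg ht, Complex.norm_natCast, Complex.mul_re, Complex.ofReal_re,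
    Complex.ofReal_im, mul_zero, sub_zero, neg_neg, Real.rpow_natCast]
  ring

/-- The curve `∑ j ≤ m, exp (μ t) t ^ j / j! • w j` along a Jordan chain `w` solves `u' = M u`
up to the contribution of the term after the last one. -/
lemma hasDerivAt_jordanChain {M : Matrix n n ℂ} {μ : ℂ} {w : ℕ → n → ℂ}
    (hw : ∀ j, M *ᵥ w j = μ • w j + w (j + 1)) (m : ℕ) (t : ℝ) :
    HasDerivAt
      (fun t : ℝ => ∑ j ∈ Finset.range (m + 1),
        (Complex.exp (μ * t) * ((t : ℂ) ^ j / (j.factorial : ℂ))) • w j)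
      (M *ᵥ (∑ j ∈ Finset.range (m + 1),
        (Complex.exp (μ * t) * ((t : ℂ) ^ j / (j.factorial : ℂ))) • w j) -
        (Complex.exp (μ * t) * ((t : ℂ) ^ m / (m.factorial : ℂ))) • w (m + 1)) t := by
  have hid : HasDerivAt (fun s : ℝ => (s : ℂ)) 1 t := Complex.ofRealCLM.hasDerivAt
  have hexp : HasDerivAt (fun s : ℝ => Complex.exp (μ * s)) (Complex.exp (μ * t) * μ) t := by
    simpa using (hid.const_mul μ).cexp
  induction m with
  | zero =>
    simp only [zero_add, Finset.range_one, Finset.sum_singleton, pow_zero, Nat.factorial_zero,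
      Nat.cast_one, div_one, mul_one, mulVec_smul, hw]
    refine (hexp.smul_const (w 0)).congr_deriv ?_
    module
  | succ m ih =>
    simp only [Finset.sum_range_succ _ (m + 1)]
    have hpow : HasDerivAt (fun s : ℝ => (s : ℂ) ^ (m + 1) / ((m + 1).factorial : ℂ))
        ((t : ℂ) ^ m / (m.factorial : ℂ)) t := by
      refine ((hid.fun_pow (m + 1)).div_const ((m + 1).factorial : ℂ)).congr_deriv ?_
      have := Nat.cast_ne_zero (R := ℂ).2 m.factorial_ne_zero
      have : (m + 1 : ℂ) ≠ 0 := by exact_mod_cast m.succ_ne_zero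
      simp only [Nat.factorial_succ, Nat.cast_mul, Nat.cast_add, Nat.cast_one, mul_one,
        Nat.add_sub_cancel]
      field_simp
    refine (ih.fun_add ((hexp.fun_mul hpow).smul_const (w (m + 1)))).congr_deriv ?_
    simp only [mulVec_add, mulVec_smul, hw]
    module

lemma jordanChain_mem_decayingSubmodule {M : Matrix n n ℂ} {μ : ℂ} (hμ : μ.re < 0)
    {w : ℕ → n → ℂ} (hw : ∀ j, M *ᵥ w j = μ • w j + w (j + 1)) {m : ℕ} (hm : w m = 0) :
    w 0 ∈ decayingSubmodule M := by
  have hm' : w (m + 1) = 0 := by simpa [hm] using (hw m).symm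
  refine ⟨fun t : ℝ => ∑ j ∈ Finset.range (m + 1),
        (Complex.exp (μ * t) * ((t : ℂ) ^ j / (j.factorial : ℂ))) • w j, ?_, fun t => ?_, ?_⟩
  · simp [Finset.sum_range_succ']
  · simpa [hm'] using hasDerivAt_jordanChain hw m t
  · simpa using tendsto_finsetSum (Finset.range (m + 1)) fun j _ =>
      (tendsto_cexp_mul_pow_div_factorial hμ j).smul_const (w j)

lemma star_dotProduct_lyapunov_mulVec (K M : Matrix n n ℂ) (x y : n → ℂ) :
    star x ⬝ᵥ (K * M + Mᴴ * K) *ᵥ y =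
      star (M *ᵥ x) ⬝ᵥ K *ᵥ y + star x ⬝ᵥ K *ᵥ (M *ᵥ y) := by
  rw [add_mulVec, dotProduct_add, ← mulVec_mulVec, ← mulVec_mulVec, star_mulVec,
    dotProduct_mulVec _ Mᴴ, add_comm]

/-- A Hermitian form that is nonpositive on a subspace has its isotropic vectors there in the
radical of the restriction. -/
lemma dotProduct_mulVec_eq_zero_of_nonpos {K : Matrix n n ℂ} (hK : K.IsHermitian)
    {V : Submodule ℂ (n → ℂ)} (hV : ∀ x ∈ V, (star x ⬝ᵥ K *ᵥ x).re ≤ 0) {x y : n → ℂ}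
    (hx : x ∈ V) (hx0 : (star x ⬝ᵥ K *ᵥ x).re = 0) (hy : y ∈ V) : star y ⬝ᵥ K *ᵥ x = 0 := by
  set c := star y ⬝ᵥ K *ᵥ x with hc
  have hconj : star x ⬝ᵥ K *ᵥ y = star c := by
    rw [hc, star_dotProduct, star_mulVec, hK.eq, dotProduct_mulVec]
  have key (t : ℝ) : 2 * t * Complex.normSq c +
      t ^ 2 * Complex.normSq c * (star y ⬝ᵥ K *ᵥ y).re ≤ 0 := by
    have h := hV (x + ((t : ℂ) * c) • y) (V.add_mem hx (V.smul_mem _ hy))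
    have e : star (x + ((t : ℂ) * c) • y) ⬝ᵥ K *ᵥ (x + ((t : ℂ) * c) • y) =
        star x ⬝ᵥ K *ᵥ x + ((2 * t * Complex.normSq c : ℝ) : ℂ) +
          ((t ^ 2 * Complex.normSq c : ℝ) : ℂ) * (star y ⬝ᵥ K *ᵥ y) := by
      simp only [star_add, star_smul, mulVec_add, mulVec_smul, dotProduct_add, add_dotProduct,
        smul_dotProduct, dotProduct_smul, hconj, ← hc, smul_eq_mul, star_mul', Complex.star_def,
        Complex.conj_ofReal]
      push_cast
      rw [← Complex.mul_conj]
      ring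
    rw [e, Complex.add_re, Complex.add_re, hx0, Complex.ofReal_re, Complex.re_ofReal_mul] at h
    linarith
  have hq := hV y hy
  set q := (star y ⬝ᵥ K *ᵥ y).re
  have h := key (1 / (1 - q))
  have hpos : 0 < 1 - q := by linarith
  have e : 2 * (1 / (1 - q)) * Complex.normSq c + (1 / (1 - q)) ^ 2 * Complex.normSq c * q =
      Complex.normSq c * ((2 - q) / (1 - q) ^ 2) := by
    field_simp
    ring
  rw [e] at h
  have : 0 < (2 - q) / (1 - q) ^ 2 := div_pos (by linarith) (by positivity)
  exact Complex.normSq_eq_zero.1 (le_antisymm (by nlinarith) (Complex.normSq_nonneg c))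

open scoped ComplexOrder

/-- Hermitian `K` is a Lyapunov form for `M`: `K M + Mᴴ K` is positive semidefinite and its kernel
contains no eigenvector of `M`. -/
structure IsLyapunovForm (K M : Matrix n n ℂ) : Prop where
  isHermitian : K.IsHermitian
  posSemidef : (K * M + Mᴴ * K).PosSemidef
  eq_zero_of_mulVec_eq_zero : ∀ (z : ℂ) (v : n → ℂ),
    (K * M + Mᴴ * K) *ᵥ v = 0 → M *ᵥ v = z • v → v = 0

namespace IsLyapunovForm

variable {K M : Matrix n n ℂ}

lemma neg (h : IsLyapunovForm K M) : IsLyapunovForm (-K) (-M) where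
  isHermitian := h.isHermitian.neg
  posSemidef := by simpa using h.posSemidef
  eq_zero_of_mulVec_eq_zero z v hv hz :=
    h.eq_zero_of_mulVec_eq_zero (-z) v (by simpa using hv)
      (by rw [neg_smul, ← hz, neg_mulVec, neg_neg])

lemma re_nonpos (h : IsLyapunovForm K M) {x : n → ℂ} (hx : x ∈ decayingSubmodule M) :
    (star x ⬝ᵥ K *ᵥ x).re ≤ 0 := by
  obtain ⟨u, rfl, hu, hu'⟩ := hx
  have hderiv (t : ℝ) : HasDerivAt (fun s => (star (u s) ⬝ᵥ K *ᵥ u s).re)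
      (star (u t) ⬝ᵥ (K * M + Mᴴ * K) *ᵥ u t).re t := by
    rw [star_dotProduct_lyapunov_mulVec]
    exact Complex.reCLM.hasFDerivAt.comp_hasDerivAt t
      ((hu t).star.matrix_dotProduct ((hu t).matrix_mulVec K))
  have hmono := monotone_of_hasDerivAt_nonneg hderiv fun t => h.posSemidef.re_dotProduct_nonneg _
  refine hmono.ge_of_tendsto ?_ 0
  have hc : Continuous fun y : n → ℂ => (star y ⬝ᵥ K *ᵥ y).re := by
    simp only [dotProduct]
    fun_prop
  have hlim := (hc.tendsto 0).comp hu'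
  rwa [mulVec_zero, dotProduct_zero, Complex.zero_re] at hlim

end IsLyapunovForm

variable [DecidableEq n]

lemma maxGenEigenspace_le_decayingSubmodule (M : Matrix n n ℂ) {μ : ℂ} (hμ : μ.re < 0) :
    Module.End.maxGenEigenspace (toLin' M) μ ≤ decayingSubmodule M := by
  intro x hx
  obtain ⟨m, hm⟩ := (Module.End.mem_maxGenEigenspace _ _ _).1 hx
  refine jordanChain_mem_decayingSubmodule hμ
    (w := fun j => ((toLin' M - μ • (1 : Module.End ℂ (n → ℂ))) ^ j) x) (fun j => ?_) hm
  rw [pow_succ']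
  simp [toLin'_apply]

lemma maxGenEigenspace_le_decayingSubmodule_neg (M : Matrix n n ℂ) {μ : ℂ} (hμ : 0 < μ.re) :
    Module.End.maxGenEigenspace (toLin' M) μ ≤ decayingSubmodule (-M) := by
  refine le_trans (fun x hx => ?_)
    (maxGenEigenspace_le_decayingSubmodule (-M) (μ := -μ) (by simpa using hμ))
  rw [Module.End.mem_maxGenEigenspace] at hx ⊢
  obtain ⟨m, hm⟩ := hx
  refine ⟨m, ?_⟩
  have e : toLin' (-M) - (-μ) • (1 : Module.End ℂ (n → ℂ)) =
      (-1 : ℂ) • (toLin' M - μ • (1 : Module.End ℂ (n → ℂ))) := by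
    rw [map_neg]
    module
  rw [e, _root_.smul_pow, LinearMap.smul_apply, hm, smul_zero]

namespace IsLyapunovForm

variable {K M M' : Matrix n n ℂ}

lemma eq_zero_of_re_eq_zero (h : IsLyapunovForm K M) {x : n → ℂ}
    (hx : x ∈ decayingSubmodule M) (hx0 : (star x ⬝ᵥ K *ᵥ x).re = 0) : x = 0 := by
  let N : Submodule ℂ (n → ℂ) :=
    { carrier := {x | x ∈ decayingSubmodule M ∧ ∀ y ∈ decayingSubmodule M, star y ⬝ᵥ K *ᵥ x = 0}
      add_mem' := fun ha hb => ⟨Submodule.add_mem _ ha.1 hb.1, fun y hy => by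
        rw [mulVec_add, dotProduct_add, ha.2 y hy, hb.2 y hy, add_zero]⟩
      zero_mem' := ⟨Submodule.zero_mem _, fun y _ => by simp⟩
      smul_mem' := fun c a ha => ⟨Submodule.smul_mem _ c ha.1, fun y hy => by
        rw [mulVec_smul, dotProduct_smul, ha.2 y hy, smul_zero]⟩ }
  have hker {v : n → ℂ} (hv : v ∈ N) : (K * M + Mᴴ * K) *ᵥ v = 0 := by
    rw [← h.posSemidef.dotProduct_mulVec_zero_iff, star_dotProduct_lyapunov_mulVec,
      hv.2 _ (mulVec_mem_decayingSubmodule hv.1), zero_add]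
    have := congrArg star (hv.2 _ (mulVec_mem_decayingSubmodule hv.1))
    rwa [star_dotProduct, star_star, star_mulVec, h.isHermitian.eq, star_zero,
      ← dotProduct_mulVec] at this
  have hinv : ∀ v ∈ N, toLin' M v ∈ N := fun v hv =>
    ⟨mulVec_mem_decayingSubmodule hv.1, fun y hy => by
      have := star_dotProduct_lyapunov_mulVec K M y v
      rw [hker hv, dotProduct_zero, hv.2 _ (mulVec_mem_decayingSubmodule hy), zero_add] at this
      exact this.symm⟩
  have hN : x ∈ N := ⟨hx, fun y hy =>
    dotProduct_mulVec_eq_zero_of_nonpos h.isHermitian (fun _ => h.re_nonpos) hx hx0 hy⟩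
  by_contra hne
  have : Nontrivial N := ⟨⟨x, hN⟩, 0, fun e => hne (congrArg Subtype.val e)⟩
  obtain ⟨z, hz⟩ := Module.End.exists_eigenvalue ((toLin' M).restrict hinv)
  obtain ⟨v, hv⟩ := hz.exists_hasEigenvector
  refine hv.2 (Subtype.ext (h.eq_zero_of_mulVec_eq_zero z v (hker v.2) ?_))
  exact congrArg Subtype.val hv.apply_eq_smul

lemma disjoint_decayingSubmodule (h : IsLyapunovForm K M) (h' : IsLyapunovForm K M') :
    Disjoint (decayingSubmodule M) (decayingSubmodule (-M')) := by
  rw [Submodule.disjoint_def]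
  intro x hx hx'
  refine h.eq_zero_of_re_eq_zero hx (le_antisymm (h.re_nonpos hx) ?_)
  simpa [neg_mulVec] using h'.neg.re_nonpos hx'

lemma re_ne_zero (h : IsLyapunovForm K M) {z : ℂ} (hz : z ∈ M.charpoly.roots) : z.re ≠ 0 := by
  intro hre
  have hroot : (toLin' M).charpoly.IsRoot z := by
    rw [Matrix.charpoly_toLin']
    exact (mem_roots'.1 hz).2
  obtain ⟨v, hv⟩ :=
    ((Module.End.hasEigenvalue_iff_isRoot_charpoly _ _).2 hroot).exists_hasEigenvector
  have hMv : M *ᵥ v = z • v := hv.apply_eq_smul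
  refine hv.2 (h.eq_zero_of_mulVec_eq_zero z v ?_ hMv)
  rw [← h.posSemidef.dotProduct_mulVec_zero_iff, star_dotProduct_lyapunov_mulVec, hMv,
    star_smul, mulVec_smul, smul_dotProduct, dotProduct_smul, ← add_smul, Complex.star_def,
    add_comm, Complex.add_conj, hre]
  simp

end IsLyapunovForm

lemma finrank_finset_sup_maxGenEigenspace_le (M : Matrix n n ℂ) (p : ℂ → Prop)
    [DecidablePred p] :
    Module.finrank ℂ ((M.charpoly.roots.toFinset.filter p).sup
      (Module.End.maxGenEigenspace (toLin' M)) : Submodule ℂ (n → ℂ)) ≤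
      (M.charpoly.roots.filter p).card := by
  have hsub (s : Finset ℂ) : Module.finrank ℂ
      (s.sup (Module.End.maxGenEigenspace (toLin' M)) : Submodule ℂ (n → ℂ)) ≤
      ∑ z ∈ s, M.charpoly.roots.count z := by
    induction s using Finset.induction_on with
    | empty => simp
    | insert a s ha ih =>
      rw [Finset.sup_insert, Finset.sum_insert ha]
      refine (Submodule.finrank_add_le_finrank_add_finrank _ _).trans (add_le_add ?_ ih)
      rw [LinearMap.finrank_maxGenEigenspace_eq, Matrix.charpoly_toLin', count_roots]
  refine (hsub _).trans_eq ?_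
  rw [← Multiset.toFinset_filter, ← Multiset.toFinset_sum_count_eq]
  refine Finset.sum_congr rfl fun z hz => ?_
  rw [Multiset.count_filter_of_pos (Multiset.mem_filter.1 (Multiset.mem_toFinset.1 hz)).2]

lemma finset_sup_maxGenEigenspace_eq_top (M : Matrix n n ℂ) :
    M.charpoly.roots.toFinset.sup (Module.End.maxGenEigenspace (toLin' M)) = ⊤ := by
  rw [eq_top_iff, ← Module.End.iSup_maxGenEigenspace_eq_top (toLin' M)]
  refine iSup_le fun z => ?_
  by_cases hz : z ∈ M.charpoly.roots
  · exact Finset.le_sup (f := Module.End.maxGenEigenspace (toLin' M)) (Multiset.mem_toFinset.2 hz)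
  · have : Module.finrank ℂ (Module.End.maxGenEigenspace (toLin' M) z) = 0 := by
      rw [LinearMap.finrank_maxGenEigenspace_eq, Matrix.charpoly_toLin', ← count_roots,
        Multiset.count_eq_zero_of_notMem hz]
    rw [Submodule.finrank_eq_zero.1 this]
    exact bot_le

namespace IsLyapunovForm

variable {K M M' : Matrix n n ℂ}

lemma card_roots_add (h : IsLyapunovForm K M) :
    (M.charpoly.roots.filter fun z => z.re < 0).card +
      (M.charpoly.roots.filter fun z => 0 < z.re).card = Fintype.card n := by
  have hpos : (M.charpoly.roots.filter fun z => 0 < z.re) =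
      M.charpoly.roots.filter fun z => ¬ z.re < 0 :=
    Multiset.filter_congr fun z hz => by
      rw [not_lt]
      exact ⟨le_of_lt, fun hle => lt_of_le_of_ne hle (h.re_ne_zero hz).symm⟩
  rw [hpos, ← Multiset.card_add, Multiset.filter_add_not,
    ← (IsAlgClosed.splits M.charpoly).natDegree_eq_card_roots, charpoly_natDegree_eq_dim]

/-- The negative spectral subspace of one matrix and the positive one of another matrix with the
same Lyapunov form are disjoint. -/
lemma finrank_sup_add_finrank_sup_le (h : IsLyapunovForm K M) (h' : IsLyapunovForm K M') :
    Module.finrank ℂ ((M.charpoly.roots.toFinset.filter fun z => z.re < 0).sup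
      (Module.End.maxGenEigenspace (toLin' M)) : Submodule ℂ (n → ℂ)) +
    Module.finrank ℂ ((M'.charpoly.roots.toFinset.filter fun z => 0 < z.re).sup
      (Module.End.maxGenEigenspace (toLin' M')) : Submodule ℂ (n → ℂ)) ≤ Fintype.card n := by
  rw [← Module.finrank_fintype_fun_eq_card ℂ]
  refine Submodule.finrank_add_finrank_le_of_disjoint
    ((h.disjoint_decayingSubmodule h').mono (Finset.sup_le fun z hz => ?_)
      (Finset.sup_le fun z hz => ?_))
  · exact maxGenEigenspace_le_decayingSubmodule M (Finset.mem_filter.1 hz).2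
  · exact maxGenEigenspace_le_decayingSubmodule_neg M' (Finset.mem_filter.1 hz).2

lemma card_le_finrank_sup_add_finrank_sup (h : IsLyapunovForm K M) :
    Fintype.card n ≤
    Module.finrank ℂ ((M.charpoly.roots.toFinset.filter fun z => z.re < 0).sup
      (Module.End.maxGenEigenspace (toLin' M)) : Submodule ℂ (n → ℂ)) +
    Module.finrank ℂ ((M.charpoly.roots.toFinset.filter fun z => 0 < z.re).sup
      (Module.End.maxGenEigenspace (toLin' M)) : Submodule ℂ (n → ℂ)) := by
  refine le_trans (le_of_eq ?_) (Submodule.finrank_add_le_finrank_add_finrank _ _)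
  rw [← Finset.sup_union, ← Finset.filter_or, Finset.filter_true_of_mem fun z hz =>
    lt_or_gt_of_ne (h.re_ne_zero (Multiset.mem_toFinset.1 hz)),
    finset_sup_maxGenEigenspace_eq_top, finrank_top, Module.finrank_fintype_fun_eq_card]

/-- Matrices with a common Lyapunov form have the same number of eigenvalues in the left
half-plane. -/
lemma card_roots_re_neg_eq (h : IsLyapunovForm K M) (h' : IsLyapunovForm K M') :
    (M.charpoly.roots.filter fun z => z.re < 0).card =
      (M'.charpoly.roots.filter fun z => z.re < 0).card := by
  have h₁ := finrank_finset_sup_maxGenEigenspace_le M fun z => z.re < 0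
  have h₂ := finrank_finset_sup_maxGenEigenspace_le M fun z => 0 < z.re
  have h₃ := finrank_finset_sup_maxGenEigenspace_le M' fun z => z.re < 0
  have h₄ := finrank_finset_sup_maxGenEigenspace_le M' fun z => 0 < z.re
  have := h.card_roots_add
  have := h'.card_roots_add
  have := h.finrank_sup_add_finrank_sup_le h'
  have := h'.finrank_sup_add_finrank_sup_le h
  have := h.card_le_finrank_sup_add_finrank_sup
  have := h'.card_le_finrank_sup_add_finrank_sup
  omega

end IsLyapunovForm

open scoped MatrixOrder in
lemma posSemidef_map_ofReal {A : Matrix n n ℝ} (hA : A.PosSemidef) :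
    (A.map (algebraMap ℝ ℂ)).PosSemidef := by
  obtain ⟨B, rfl⟩ := CStarAlgebra.nonneg_iff_eq_star_mul_self.mp hA.nonneg
  have e : (star B * B).map (algebraMap ℝ ℂ) =
      (B.map (algebraMap ℝ ℂ))ᴴ * B.map (algebraMap ℝ ℂ) := by
    rw [Matrix.map_mul]
    congr 1
    ext i j
    simp [star_eq_conjTranspose]
  rw [e]
  exact posSemidef_conjTranspose_mul_self _

lemma isLyapunovForm_inv_map {H A J : Matrix n n ℝ} (hH : Hᵀ = H) (hdet : IsUnit H.det)
    (hA : A.PosSemidef) (hJ : Jᵀ = -J)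
    (hker : ∀ (z : ℂ) (v : n → ℂ), (A.map (algebraMap ℝ ℂ)) *ᵥ v = 0 →
      ((H * J).map (algebraMap ℝ ℂ)) *ᵥ v = z • v → v = 0) :
    IsLyapunovForm (H⁻¹.map (algebraMap ℝ ℂ))
      ((H * ((2 : ℝ) • A + J)).map (algebraMap ℝ ℂ)) := by
  have hreal : H⁻¹ * (H * ((2 : ℝ) • A + J)) + (H * ((2 : ℝ) • A + J))ᵀ * H⁻¹ = (4 : ℝ) • A := by
    have hAt : Aᵀ = A := by simpa using hA.isHermitian.eq
    rw [transpose_mul, hH, nonsing_inv_mul_cancel_left _ _ hdet,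
      mul_nonsing_inv_cancel_right _ _ hdet, transpose_add, transpose_smul, hAt, hJ]
    module
  have hconj (B : Matrix n n ℝ) :
      (B.map (algebraMap ℝ ℂ))ᴴ = Bᵀ.map (algebraMap ℝ ℂ) := by
    ext i j
    simp
  have hS : H⁻¹.map (algebraMap ℝ ℂ) * (H * ((2 : ℝ) • A + J)).map (algebraMap ℝ ℂ) +
      ((H * ((2 : ℝ) • A + J)).map (algebraMap ℝ ℂ))ᴴ * H⁻¹.map (algebraMap ℝ ℂ) =
      (4 : ℝ) • A.map (algebraMap ℝ ℂ) := by
    rw [hconj, ← Matrix.map_mul, ← Matrix.map_mul, ← Matrix.map_add _ (map_add _), hreal]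
    ext i j
    simp
  refine ⟨?_, ?_, fun z v hv hz => ?_⟩
  · rw [IsHermitian, hconj, transpose_nonsing_inv, hH]
  · rw [hS]
    exact (posSemidef_map_ofReal hA).smul (by norm_num)
  · have hAv : (A.map (algebraMap ℝ ℂ)) *ᵥ v = 0 := by
      rw [hS, smul_mulVec] at hv
      exact (smul_eq_zero.1 hv).resolve_left (by norm_num)
    refine hker z v hAv ?_
    rw [← hz, mul_add, Matrix.map_add _ (map_add _), add_mulVec, mul_smul_comm, ← smul_mul_assoc,
      Matrix.map_mul (L := _ • H), ← mulVec_mulVec, hAv, mulVec_zero, zero_add]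

lemma aroots_charpoly_eq_roots_map (M : Matrix n n ℝ) :
    M.charpoly.aroots ℂ = (M.map (algebraMap ℝ ℂ)).charpoly.roots := by
  rw [charpoly_map, aroots_def]

end

lemma im_eq_zero_of_card_filter_re_neg_eq_one {p : ℝ[X]}
    (hp : ((p.aroots ℂ).filter fun z => z.re < 0).card = 1) {z : ℂ} (hz : z ∈ p.aroots ℂ)
    (hre : z.re < 0) : z.im = 0 := by
  obtain ⟨a, ha⟩ := Multiset.card_eq_one.1 hp
  have hmem (w : ℂ) (hw : w ∈ p.aroots ℂ) (hwre : w.re < 0) : w = a := by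
    rw [← Multiset.mem_singleton, ← ha]
    exact Multiset.mem_filter.2 ⟨hw, hwre⟩
  have hconj : starRingEnd ℂ z ∈ p.aroots ℂ := by
    rw [mem_aroots] at hz ⊢
    exact ⟨hz.1, by rw [aeval_conj, hz.2, map_zero]⟩
  rw [← Complex.conj_eq_iff_im, hmem _ hconj (by simpa using hre), hmem z hz hre]

theorem eigenvalue_count_of_Lambda
    (d k : ℕ) (hd : 1 ≤ d) (hk : k ≤ d)
    (H A J : Matrix (Fin d) (Fin d) ℝ)
    (hHsymm : Hᵀ = H) (hHinv : IsUnit H.det)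
    (hHneg : (Multiset.filter (fun z => z.re < 0) (H.charpoly.aroots ℂ)).card = k)
    (hHpos : (Multiset.filter (fun z => 0 < z.re) (H.charpoly.aroots ℂ)).card = d - k)
    (hAsymm : Aᵀ = A) (hApsd : ∀ x : Fin d → ℝ, 0 ≤ x ⬝ᵥ A.mulVec x)
    (hJanti : Jᵀ = -J)
    (hker : ∀ (z : ℂ) (v : Fin d → ℂ),
      (A.map (algebraMap ℝ ℂ)).mulVec v = 0 →
      ((H * J).map (algebraMap ℝ ℂ)).mulVec v = z • v → v = 0) :
    (Multiset.filter (fun z => z.re < 0)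
        ((H * ((2 : ℝ) • A + J)).charpoly.aroots ℂ)).card = k ∧
    (Multiset.filter (fun z => 0 < z.re)
        ((H * ((2 : ℝ) • A + J)).charpoly.aroots ℂ)).card = d - k ∧
    (∀ z ∈ (H * ((2 : ℝ) • A + J)).charpoly.aroots ℂ, z.re ≠ 0) ∧
    (k = 1 → ∀ z ∈ (H * ((2 : ℝ) • A + J)).charpoly.aroots ℂ,
      z.re < 0 → z.im = 0) := by
  have hA : A.PosSemidef := .of_dotProduct_mulVec_nonneg (by simpa [IsHermitian] using hAsymm)
    (by simpa using hApsd)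
  have hΛ := isLyapunovForm_inv_map hHsymm hHinv hA hJanti hker
  have hH := isLyapunovForm_inv_map (A := (2⁻¹ : ℝ) • (1 : Matrix (Fin d) (Fin d) ℝ)) (J := 0)
    hHsymm hHinv (PosSemidef.one.smul (by norm_num)) (by simp) fun z v hv _ => by
      have e : ((2⁻¹ : ℝ) • (1 : Matrix (Fin d) (Fin d) ℝ)).map (algebraMap ℝ ℂ) =
          (2⁻¹ : ℝ) • (1 : Matrix (Fin d) (Fin d) ℂ) := by
        ext i j
        simp [one_apply, apply_ite]
      rw [e, smul_mulVec, one_mulVec] at hv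
      exact (smul_eq_zero.1 hv).resolve_left (by norm_num)
  rw [smul_inv_smul₀ two_ne_zero, add_zero, mul_one] at hH
  rw [aroots_charpoly_eq_roots_map] at hHneg
  have hneg := (hΛ.card_roots_re_neg_eq hH).trans hHneg
  have hsum := hΛ.card_roots_add
  rw [Fintype.card_fin, hneg] at hsum
  rw [← aroots_charpoly_eq_roots_map] at hneg hsum
  refine ⟨hneg, by omega, fun z hz => hΛ.re_ne_zero ?_, fun hk1 z hz hre =>
    im_eq_zero_of_card_filter_re_neg_eq_one (hneg.trans hk1) hz hre⟩
  rwa [← aroots_charpoly_eq_roots_map]
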